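/- Let F_n denote the Fibonacci numbers and L_n the Lucas numbers. Then ∑_{n=1}^{∞} L( 1/(5·F_{2n}²) ) + ∑_{n=1}^{∞} L( 1/L_{2n+1}² ) = π²/15. -/

import Mathlib

/-- The Rogers dilogarithm on `[0,1]`: `L(x) = Li₂(x) + (1/2)·log x · log (1-x)`
for `0 < x < 1`, with `L 0 = 0` and `L 1 = π²/6`. -/
noncomputable def rogersL (x : ℝ) : ℝ :=
  if x = 0 then 0
  else if x = 1 then Real.pi ^ 2 / 6
  else (∑' n : ℕ, x ^ (n + 1) / ((n : ℝ) + 1) ^ 2) + 1 / 2 * Real.log x * Real.log (1 - x)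

/-- The Lucas numbers: `L 0 = 2`, `L 1 = 1`, `L (n+2) = L (n+1) + L n`. -/
def lucasNum : ℕ → ℕ
  | 0 => 2
  | 1 => 1
  | n + 2 => lucasNum (n + 1) + lucasNum n

open Filter Topology Set

theorem continuousAt_log_mul_log_one_sub_zero :
    ContinuousAt (fun x : ℝ => Real.log x * Real.log (1 - x)) 0 := by
  have hlim : Tendsto (fun x : ℝ => 2 * |x * Real.log x|) (𝓝 0) (𝓝 0) := by
    have h := ((Real.continuous_mul_log.abs).const_mul 2).tendsto 0
    simpa using h
  have hbound : ∀ᶠ x : ℝ in 𝓝 0, ‖Real.log x * Real.log (1 - x)‖ ≤ 2 * |x * Real.log x| := by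
    have hball : ∀ᶠ x : ℝ in 𝓝 0, |x| < 1 / 2 := by
      have h : ContinuousAt (fun x : ℝ => |x|) 0 := continuous_abs.continuousAt
      exact h.eventually_lt continuousAt_const (by norm_num)
    filter_upwards [hball] with x hx
    have h := Real.abs_log_sub_add_sum_range_le (x := x) (by linarith) 0
    simp only [Finset.range_zero, Finset.sum_empty, zero_add, pow_one] at h
    have h2 : |x| / (1 - |x|) ≤ 2 * |x| := by
      rw [div_le_iff₀ (by linarith)]
      nlinarith [abs_nonneg x]
    rw [Real.norm_eq_abs, abs_mul, abs_mul]
    nlinarith [abs_nonneg (Real.log x)]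
  have h := squeeze_zero_norm' hbound hlim
  simpa [ContinuousAt] using h

theorem continuousOn_log_mul_log_one_sub :
    ContinuousOn (fun x : ℝ => Real.log x * Real.log (1 - x)) (Icc 0 1) := by
  intro x _
  apply ContinuousAt.continuousWithinAt
  by_cases h0 : x = 0
  · exact h0 ▸ continuousAt_log_mul_log_one_sub_zero
  by_cases h1 : x = 1
  · subst h1
    have hc : ContinuousAt (fun x : ℝ => 1 - x) 1 := by fun_prop
    have h := ContinuousAt.comp_of_eq continuousAt_log_mul_log_one_sub_zero hc (by norm_num)
    convert h using 2 with x
    simp [mul_comm]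
  · have h1' : 1 - x ≠ 0 := sub_ne_zero.mpr (Ne.symm h1)
    fun_prop (disch := assumption)

theorem summable_one_div_succ_sq : Summable fun n : ℕ => 1 / ((n : ℝ) + 1) ^ 2 := by
  have h := (summable_nat_add_iff 1).mpr hasSum_zeta_two.summable
  simpa using h

theorem tsum_one_div_succ_sq : ∑' n : ℕ, 1 / ((n : ℝ) + 1) ^ 2 = Real.pi ^ 2 / 6 := by
  have h := hasSum_zeta_two.summable.tsum_eq_zero_add
  rw [hasSum_zeta_two.tsum_eq] at h
  simpa using h.symm

theorem rogersL_eq (x : ℝ) : rogersL x =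
    (∑' n : ℕ, x ^ (n + 1) / ((n : ℝ) + 1) ^ 2) + 1 / 2 * (Real.log x * Real.log (1 - x)) := by
  unfold rogersL
  split_ifs with h0 h1
  · simp [h0]
  · subst h1
    simpa using tsum_one_div_succ_sq.symm
  · ring

theorem norm_dilog_term_le {x : ℝ} (hx : x ∈ Icc (0 : ℝ) 1) (n : ℕ) :
    ‖x ^ (n + 1) / ((n : ℝ) + 1) ^ 2‖ ≤ 1 / ((n : ℝ) + 1) ^ 2 := by
  have := hx.1
  rw [Real.norm_of_nonneg (by positivity)]
  gcongr
  exact pow_le_one₀ hx.1 hx.2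

theorem continuousOn_rogersL : ContinuousOn rogersL (Icc 0 1) := by
  rw [show rogersL = _ from funext rogersL_eq]
  refine ContinuousOn.add ?_ (continuousOn_log_mul_log_one_sub.const_smul (1 / 2 : ℝ))
  exact continuousOn_tsum (fun n => by fun_prop) summable_one_div_succ_sq
    fun n x hx => norm_dilog_term_le hx n

theorem rogersL_nonneg {x : ℝ} (hx : x ∈ Icc (0 : ℝ) 1) : 0 ≤ rogersL x := by
  have h0 := hx.1
  have h1 := hx.2
  rw [rogersL_eq]
  have := mul_nonneg_of_nonpos_of_nonpos (Real.log_nonpos h0 h1)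
    (Real.log_nonpos (x := 1 - x) (by linarith) (by linarith))
  have : 0 ≤ ∑' n : ℕ, x ^ (n + 1) / ((n : ℝ) + 1) ^ 2 := tsum_nonneg fun n => by positivity
  linarith

theorem hasDerivAt_dilog {x : ℝ} (hx : x ∈ Ioo (0 : ℝ) 1) :
    HasDerivAt (fun x : ℝ => ∑' n : ℕ, x ^ (n + 1) / ((n : ℝ) + 1) ^ 2)
      (-Real.log (1 - x) / x) x := by
  obtain ⟨r, hxr, hr1⟩ := exists_between hx.2
  have hr0 : 0 < r := hx.1.trans hxr
  have h := hasDerivAt_tsum_of_isPreconnected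
    (g := fun (n : ℕ) (x : ℝ) => x ^ (n + 1) / ((n : ℝ) + 1) ^ 2)
    (g' := fun (n : ℕ) (x : ℝ) => x ^ n / ((n : ℝ) + 1)) (t := Ioo 0 r) (y₀ := x) (y := x)
    (summable_geometric_of_lt_one hr0.le hr1) isOpen_Ioo isPreconnected_Ioo
    (fun n y _ => by
      have h := (hasDerivAt_pow (n + 1) y).div_const (((n : ℝ) + 1) ^ 2)
      refine h.congr_deriv ?_
      push_cast
      field_simp)
    (fun n y hy => by
      have := hy.1
      rw [Real.norm_of_nonneg (by positivity)]
      calc y ^ n / ((n : ℝ) + 1) ≤ y ^ n := div_le_self (by positivity) (by simp)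
        _ ≤ r ^ n := by gcongr; exact hy.2.le)
    ⟨hx.1, hxr⟩
    (summable_one_div_succ_sq.of_norm_bounded (norm_dilog_term_le ⟨hx.1.le, hx.2.le⟩))
    ⟨hx.1, hxr⟩
  refine h.congr_deriv ?_
  have hs := (Real.hasSum_pow_div_log_of_abs_lt_one (x := x)
    (by rw [abs_of_pos hx.1]; exact hx.2)).div_const x
  rw [← hs.tsum_eq]
  have := hx.1.ne'
  congr 1 with n
  field_simp
  ring

theorem hasDerivAt_rogersL {x : ℝ} (hx : x ∈ Ioo (0 : ℝ) 1) :
    HasDerivAt rogersL (-(1 / 2) * (Real.log (1 - x) / x + Real.log x / (1 - x))) x := by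
  rw [show rogersL = _ from funext rogersL_eq]
  have h0 : x ≠ 0 := hx.1.ne'
  have h1 : 1 - x ≠ 0 := by linarith [hx.2]
  have hl := (Real.hasDerivAt_log h0).mul (((hasDerivAt_id x).const_sub 1).log h1)
  refine ((hasDerivAt_dilog hx).add (hl.const_mul (1 / 2))).congr_deriv ?_
  simp only [id]
  field_simp
  ring

theorem rogersL_zero : rogersL 0 = 0 := by simp [rogersL]

theorem rogersL_one : rogersL 1 = Real.pi ^ 2 / 6 := by simp [rogersL]

theorem eq_of_hasDerivAt_zero {f : ℝ → ℝ} {a b : ℝ} (hab : a < b) (hc : ContinuousOn f (Icc a b))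
    (hd : ∀ x ∈ Ioo a b, HasDerivAt f 0 x) : f b = f a := by
  obtain ⟨c, -, hc⟩ := exists_hasDerivAt_eq_slope f (fun _ => 0) hab hc hd
  have : b - a ≠ 0 := by linarith
  field_simp at hc
  linarith

theorem rogersL_add_rogersL_one_sub {x : ℝ} (hx : x ∈ Ioo (0 : ℝ) 1) :
    rogersL x + rogersL (1 - x) = Real.pi ^ 2 / 6 := by
  have h := eq_of_hasDerivAt_zero (f := fun t => rogersL t + rogersL (1 - t)) hx.1
    (by
      refine (continuousOn_rogersL.mono (Icc_subset_Icc_right hx.2.le)).add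
        (continuousOn_rogersL.comp (by fun_prop) fun t ht => ?_)
      exact ⟨by linarith [ht.2, hx.2], by linarith [ht.1]⟩)
    (fun t ht => by
      have ht1 : t < 1 := ht.2.trans hx.2
      have h1 : HasDerivAt rogersL _ (1 - t) :=
        hasDerivAt_rogersL ⟨by linarith, by linarith [ht.1]⟩
      refine ((hasDerivAt_rogersL ⟨ht.1, ht1⟩).add
        (h1.comp t ((hasDerivAt_id t).const_sub 1))).congr_deriv ?_
      rw [sub_sub_cancel]
      ring)
  simpa [rogersL_zero, rogersL_one] using h

/-- The five-term relation of the Rogers dilogarithm. -/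
theorem rogersL_add_rogersL {x y : ℝ} (hx : x ∈ Ioo (0 : ℝ) 1) (hy : y ∈ Ioo (0 : ℝ) 1) :
    rogersL x + rogersL y = rogersL (x * y) + rogersL (x * (1 - y) / (1 - x * y)) +
      rogersL (y * (1 - x) / (1 - x * y)) := by
  have hy0 := hy.1
  have hy1 : 0 < 1 - y := sub_pos.mpr hy.2
  have hden : ∀ t ∈ Icc 0 x, 0 < 1 - t * y := fun t ht => by nlinarith [ht.1, ht.2, hx.2]
  have hdenc : ∀ t ∈ Icc 0 x, 1 - t * y ≠ 0 := fun t ht => (hden t ht).ne'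
  have h := eq_of_hasDerivAt_zero (f := fun t => rogersL t - rogersL (t * y) -
      rogersL (t * (1 - y) / (1 - t * y)) - rogersL (y * (1 - t) / (1 - t * y))) hx.1
    (by
      refine (((continuousOn_rogersL.mono (Icc_subset_Icc_right hx.2.le)).sub
        (continuousOn_rogersL.comp (f := fun t => t * y) (by fun_prop) fun t ht => ?_)).sub
        (continuousOn_rogersL.comp (f := fun t => t * (1 - y) / (1 - t * y))
          (by fun_prop (disch := assumption)) fun t ht => ?_)).sub
        (continuousOn_rogersL.comp (f := fun t => y * (1 - t) / (1 - t * y))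
          (by fun_prop (disch := assumption)) fun t ht => ?_)
      all_goals
        have ht0 := ht.1
        have ht1 : 0 < 1 - t := by linarith [ht.2, hx.2]
        have hd := hden t ht
        refine ⟨by positivity, ?_⟩
      · nlinarith
      · rw [div_le_one hd]; nlinarith
      · rw [div_le_one hd]; nlinarith)
    (fun t ht => by
      have ht0 := ht.1
      have ht1 : 0 < 1 - t := by linarith [ht.2, hx.2]
      have hd := hden t ⟨ht.1.le, ht.2.le⟩
      have hd' := hd.ne'
      have e1 : 1 - t * (1 - y) / (1 - t * y) = (1 - t) / (1 - t * y) := by rw [eq_div_iff hd', sub_mul, div_mul_cancel₀ _ hd']; ring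
      have e2 : 1 - y * (1 - t) / (1 - t * y) = (1 - y) / (1 - t * y) := by rw [eq_div_iff hd', sub_mul, div_mul_cancel₀ _ hd']; ring
      have p1 : 0 < 1 - t * (1 - y) / (1 - t * y) := by rw [e1]; positivity
      have p2 : 0 < 1 - y * (1 - t) / (1 - t * y) := by rw [e2]; positivity
      have h0 := hasDerivAt_rogersL (x := t) ⟨ht0, by linarith⟩
      have h1 := hasDerivAt_rogersL (x := t * y) ⟨by positivity, by linarith⟩
      have h2 := hasDerivAt_rogersL (x := t * (1 - y) / (1 - t * y)) ⟨by positivity, by linarith⟩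
      have h3 := hasDerivAt_rogersL (x := y * (1 - t) / (1 - t * y)) ⟨by positivity, by linarith⟩
      have dm : HasDerivAt (fun t => t * y) y t := by
        simpa using (hasDerivAt_id t).mul_const y
      have dd := dm.const_sub 1
      have d2 := ((hasDerivAt_id t).mul_const (1 - y)).div dd hd.ne'
      have d3 := (((hasDerivAt_id t).const_sub 1).const_mul y).div dd hd.ne'
      refine (((h0.sub (h1.comp t dm)).sub (h2.comp t d2)).sub (h3.comp t d3)).congr_deriv ?_
      simp only [id]
      rw [e1, e2, Real.log_div (by positivity) hd.ne', Real.log_div (by positivity) hd.ne',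
        Real.log_div (by positivity) hd.ne', Real.log_div (by positivity) hd.ne',
        Real.log_mul ht0.ne' hy0.ne', Real.log_mul ht0.ne' hy1.ne', Real.log_mul hy0.ne' ht1.ne']
      field_simp
      ring)
  simp only [zero_mul, sub_zero, mul_one, div_one, rogersL_zero] at h
  linarith

theorem rogersL_eq_sub {p a : ℝ} (hp : p ∈ Ioo (0 : ℝ) 1) (ha : a ∈ Ioo (0 : ℝ) 1) :
    rogersL (a * (1 - p) ^ 2 / (1 - p * a) ^ 2) =
      (rogersL (p * ((1 - p * a) / (1 - p * (p * a)))) +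
        rogersL ((1 - p * a) / (1 - p * (p * a)))) -
      (rogersL (p * ((1 - a) / (1 - p * a))) + rogersL ((1 - a) / (1 - p * a))) := by
  have hp0 := hp.1
  have hp1 : 0 < 1 - p := sub_pos.mpr hp.2
  have ha0 := ha.1
  have ha1 : 0 < 1 - a := sub_pos.mpr ha.2
  have hb : 0 < 1 - p * a := by nlinarith
  have hc : 0 < 1 - p * (p * a) := by nlinarith
  have hX : p * ((1 - p * a) / (1 - p * (p * a))) ∈ Ioo (0 : ℝ) 1 := by
    refine ⟨by positivity, ?_⟩
    rw [← mul_div_assoc, div_lt_one hc]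
    linarith
  have hg : (1 - p * a) / (1 - p * (p * a)) ∈ Ioo (0 : ℝ) 1 := by
    refine ⟨by positivity, ?_⟩
    rw [div_lt_one hc]
    nlinarith [mul_pos (mul_pos hp0 ha0) hp1]
  have hY : 1 - a * (1 - p) ^ 2 / (1 - p * a) ^ 2 =
      (1 - a) * (1 - p * (p * a)) / (1 - p * a) ^ 2 := by
    rw [eq_div_iff (by positivity), sub_mul, div_mul_cancel₀ _ (by positivity)]
    ring
  have hx : a * (1 - p) ^ 2 / (1 - p * a) ^ 2 ∈ Ioo (0 : ℝ) 1 := by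
    refine ⟨by positivity, sub_pos.mp ?_⟩
    rw [hY]
    positivity
  have hx' : 1 - a * (1 - p) ^ 2 / (1 - p * a) ^ 2 ∈ Ioo (0 : ℝ) 1 :=
    ⟨sub_pos.mpr hx.2, by linarith [hx.1]⟩
  have hc' : 1 - p ^ 2 * a ≠ 0 := by convert hc.ne' using 1; ring
  have hXY : p * ((1 - p * a) / (1 - p * (p * a))) *
      (1 - a * (1 - p) ^ 2 / (1 - p * a) ^ 2) = p * ((1 - a) / (1 - p * a)) := by
    rw [hY]
    field_simp
  have hXY1 : 1 - p * ((1 - a) / (1 - p * a)) = (1 - p) / (1 - p * a) := by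
    rw [eq_div_iff hb.ne', sub_mul, mul_assoc, div_mul_cancel₀ _ hb.ne']
    ring
  have hX1 : 1 - p * ((1 - p * a) / (1 - p * (p * a))) = (1 - p) / (1 - p * (p * a)) := by
    rw [eq_div_iff hc.ne', sub_mul, mul_assoc, div_mul_cancel₀ _ hc.ne']
    ring
  have hg1 : 1 - (1 - p * a) / (1 - p * (p * a)) = p * a * (1 - p) / (1 - p * (p * a)) := by
    rw [eq_div_iff hc.ne', sub_mul, div_mul_cancel₀ _ hc.ne']
    ring
  have h := rogersL_add_rogersL hX hx'
  have e1 : p * ((1 - p * a) / (1 - p * (p * a))) *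
      (1 - (1 - a * (1 - p) ^ 2 / (1 - p * a) ^ 2)) / ((1 - p) / (1 - p * a)) =
      1 - (1 - p * a) / (1 - p * (p * a)) := by
    rw [hg1, sub_sub_cancel]
    field_simp
  have e2 : (1 - a * (1 - p) ^ 2 / (1 - p * a) ^ 2) *
      ((1 - p) / (1 - p * (p * a))) / ((1 - p) / (1 - p * a)) = (1 - a) / (1 - p * a) := by
    rw [hY]
    field_simp
    rw [mul_comm (p ^ 2)] at hc'
    field_simp
  rw [hXY, hXY1, hX1, e1, e2] at h
  linarith [rogersL_add_rogersL_one_sub hx, rogersL_add_rogersL_one_sub hg]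

theorem hasSum_rogersL {p : ℝ} (hp : p ∈ Ioo (0 : ℝ) 1) :
    HasSum (fun m : ℕ => rogersL (p ^ (m + 1) * (1 - p) ^ 2 / (1 - p ^ (m + 2)) ^ 2))
      (rogersL p) := by
  have hp0 := hp.1
  have hp1 : 0 < 1 - p := sub_pos.mpr hp.2
  have hpow (m : ℕ) : p ^ (m + 1) ∈ Ioo (0 : ℝ) 1 :=
    ⟨by positivity, pow_lt_one₀ hp0.le hp.2 m.succ_ne_zero⟩
  set g : ℕ → ℝ := fun m => (1 - p ^ (m + 1)) / (1 - p ^ (m + 2)) with hgdef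
  have hterm (m : ℕ) : rogersL (p ^ (m + 1) * (1 - p) ^ 2 / (1 - p ^ (m + 2)) ^ 2) =
      (rogersL (p * g (m + 1)) + rogersL (g (m + 1))) - (rogersL (p * g m) + rogersL (g m)) := by
    have h := rogersL_eq_sub hp (hpow m)
    simpa only [← pow_succ'] using h
  have hg (m : ℕ) : g m ∈ Icc (0 : ℝ) 1 := by
    have h1 := sub_pos.mpr (hpow m).2
    have h2 := sub_pos.mpr (hpow (m + 1)).2
    refine ⟨by positivity, ?_⟩
    rw [div_le_one h2]
    exact sub_le_sub_left (pow_le_pow_of_le_one hp0.le hp.2.le (m + 1).le_succ) 1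
  have hg_lim : Tendsto g atTop (𝓝 1) := by
    have h := tendsto_pow_atTop_nhds_zero_of_lt_one hp0.le hp.2
    have h1 := (h.comp (tendsto_add_atTop_nat 1)).const_sub 1
    have h2 := (h.comp (tendsto_add_atTop_nat 2)).const_sub 1
    simpa [hgdef, Pi.div_def] using h1.div h2 (by norm_num)
  have hL1 : Tendsto (fun m => rogersL (g m)) atTop (𝓝 (Real.pi ^ 2 / 6)) := by
    rw [← rogersL_one]
    exact (continuousOn_rogersL 1 (by simp)).tendsto.comp
      (tendsto_nhdsWithin_iff.mpr ⟨hg_lim, Eventually.of_forall hg⟩)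
  have hLp : Tendsto (fun m => rogersL (p * g m)) atTop (𝓝 (rogersL p)) := by
    refine (continuousOn_rogersL p ⟨hp0.le, hp.2.le⟩).tendsto.comp
      (tendsto_nhdsWithin_iff.mpr ⟨by simpa using hg_lim.const_mul p, Eventually.of_forall ?_⟩)
    exact fun m => ⟨mul_nonneg hp0.le (hg m).1, mul_le_one₀ hp.2.le (hg m).1 (hg m).2⟩
  have hstart : rogersL (p * g 0) + rogersL (g 0) = Real.pi ^ 2 / 6 := by
    have h0 : g 0 = 1 / (1 + p) := by
      have : 1 - p ^ 2 ≠ 0 := by nlinarith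
      simp only [hgdef, zero_add, pow_one]
      rw [div_eq_div_iff this (by positivity)]
      ring
    have h1 : p * (1 / (1 + p)) = 1 - 1 / (1 + p) := by field_simp; ring
    rw [h0, h1, add_comm]
    exact rogersL_add_rogersL_one_sub
      ⟨by positivity, by rw [div_lt_one (by positivity)]; linarith⟩
  rw [hasSum_iff_tendsto_nat_of_nonneg]
  · have h := (hLp.add hL1).sub_const (Real.pi ^ 2 / 6)
    rw [add_sub_cancel_right] at h
    refine h.congr fun n => ?_
    simp only [hterm]
    rw [Finset.sum_range_sub (fun m => rogersL (p * g m) + rogersL (g m)), hstart]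
  · intro m
    have ha := hpow m
    have hb := sub_pos.mpr (hpow (m + 1)).2
    refine rogersL_nonneg ⟨by have := ha.1; positivity, ?_⟩
    rw [div_le_one (by positivity), pow_succ p (m + 1)]
    nlinarith [mul_nonneg (sub_pos.mpr ha.2).le (sub_nonneg.mpr
      (show p * (p * p ^ (m + 1)) ≤ 1 by nlinarith [ha.1, ha.2, mul_pos hp0 ha.1]))]

/-- The value of the Rogers dilogarithm at `φ⁻²`, where `φ⁻¹ = -ψ`. -/
theorem rogersL_goldenConj_sq : rogersL (Real.goldenConj ^ 2) = Real.pi ^ 2 / 15 := by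
  obtain ⟨q, hq⟩ : ∃ q, q = -Real.goldenConj := ⟨_, rfl⟩
  have hq2 : q ^ 2 = 1 - q := by rw [hq, neg_sq, Real.goldenConj_sq]; ring
  have hqm : q ∈ Ioo (0 : ℝ) 1 :=
    ⟨by linarith [Real.goldenConj_neg], by linarith [Real.neg_one_lt_goldenConj]⟩
  have hq0 := hqm.1
  have h := rogersL_add_rogersL hqm hqm
  have e1 : q * (1 - q) / (1 - q * q) = q ^ 2 := by
    rw [← pow_two, hq2, sub_sub_cancel, mul_div_cancel_left₀ _ hq0.ne']
  rw [e1, ← pow_two] at h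
  have h' := rogersL_add_rogersL_one_sub hqm
  rw [← hq2] at h'
  rw [← neg_sq, ← hq]
  linarith

theorem coe_lucasNum_eq (n : ℕ) :
    (lucasNum n : ℝ) = Real.goldenRatio ^ n + Real.goldenConj ^ n := by
  induction n using Nat.twoStepInduction with
  | zero => norm_num [lucasNum]
  | one => simp [lucasNum]
  | more n h0 h1 =>
    rw [lucasNum, Nat.cast_add, h0, h1, pow_add _ n 2, pow_add _ n 2, Real.goldenRatio_sq,
      Real.goldenConj_sq]
    ring

theorem one_div_goldenRatio_pow_sub_sq (k : ℕ) :
    1 / (Real.goldenRatio ^ (k + 2) - (-Real.goldenConj) ^ (k + 2)) ^ 2 =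
      (Real.goldenConj ^ 2) ^ (k + 1) * (1 - Real.goldenConj ^ 2) ^ 2 /
        (1 - (Real.goldenConj ^ 2) ^ (k + 2)) ^ 2 := by
  have hne := pow_ne_zero (k + 2) (neg_ne_zero.mpr Real.goldenConj_ne_zero)
  have hφ : Real.goldenRatio ^ (k + 2) * (-Real.goldenConj) ^ (k + 2) = 1 := by
    rw [← mul_pow, mul_neg, Real.goldenRatio_mul_goldenConj, neg_neg, one_pow]
  have hp : (1 - Real.goldenConj ^ 2) ^ 2 = Real.goldenConj ^ 2 := by
    rw [Real.goldenConj_sq, sub_add_cancel_right, neg_sq, Real.goldenConj_sq]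
  have hpow : (Real.goldenConj ^ 2) ^ (k + 2) = ((-Real.goldenConj) ^ (k + 2)) ^ 2 := by
    rw [← pow_mul, ← pow_mul, mul_comm (k + 2), (even_two_mul (k + 2)).neg_pow]
  rw [hp, ← pow_succ, hpow, eq_div_of_mul_eq hne hφ]
  generalize (-Real.goldenConj) ^ (k + 2) = b at hne
  field_simp

theorem stmt_17 :
    (∑' n : ℕ, rogersL (1 / (5 * (Nat.fib (2 * (n + 1)) : ℝ) ^ 2))) +
      (∑' n : ℕ, rogersL (1 / (lucasNum (2 * (n + 1) + 1) : ℝ) ^ 2)) =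
      Real.pi ^ 2 / 15 := by
  have hp : Real.goldenConj ^ 2 ∈ Ioo (0 : ℝ) 1 :=
    ⟨by have := Real.goldenConj_ne_zero; positivity,
      by rw [Real.goldenConj_sq]; linarith [Real.goldenConj_neg]⟩
  have h := hasSum_rogersL hp
  simp only [← one_div_goldenRatio_pow_sub_sq] at h
  have heven (n : ℕ) : 5 * (Nat.fib (2 * (n + 1)) : ℝ) ^ 2 =
      (Real.goldenRatio ^ (2 * n + 2) - (-Real.goldenConj) ^ (2 * n + 2)) ^ 2 := by
    rw [Real.coe_fib_eq, div_pow, Real.sq_sqrt (by norm_num), mul_div_cancel₀ _ (by norm_num),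
      ← mul_add_one 2 n, (even_two_mul (n + 1)).neg_pow]
  have hodd (n : ℕ) : (lucasNum (2 * (n + 1) + 1) : ℝ) =
      Real.goldenRatio ^ (2 * n + 1 + 2) - (-Real.goldenConj) ^ (2 * n + 1 + 2) := by
    rw [coe_lucasNum_eq, show 2 * n + 1 + 2 = 2 * (n + 1) + 1 by ring,
      (odd_two_mul_add_one (n + 1)).neg_pow, sub_neg_eq_add]
  simp only [heven, hodd]
  rw [← rogersL_goldenConj_sq, ← h.tsum_eq]
  generalize hf : (fun m : ℕ => rogersL
    (1 / (Real.goldenRatio ^ (m + 2) - (-Real.goldenConj) ^ (m + 2)) ^ 2)) = f at h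
  have hs := h.summable
  have hsplit := tsum_even_add_odd
    (hs.comp_injective (i := fun k : ℕ => 2 * k) fun a b hab => by simpa using hab)
    (hs.comp_injective (i := fun k : ℕ => 2 * k + 1) fun a b hab => by simpa using hab)
  simpa only [← hf] using hsplit
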